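/- arXiv:2505.02058 — 2 statements merged into one kernel-verified Lean document; each statement's English description precedes it below -/
import Mathlib

section
/- Fix an integer k ≥ 0. The weak law of large numbers holds for the inversion statistic on random permutations with exactly k fixed points: for every ε > 0, lim_{n→∞} #{σ ∈ D_{n,k} : (1−ε)·n²/4 ≤ I(σ) ≤ (1+ε)·n²/4} / d_{n,k} = 1. -/
/-- Number of inversions of a permutation of `Fin n`: the number of pairs of
positions `a < b` with `σ a > σ b`. -/
def inversions {n : ℕ} (σ : Equiv.Perm (Fin n)) : ℕ :=
  ((Finset.univ : Finset (Fin n × Fin n)).filter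
    (fun p => p.1 < p.2 ∧ σ p.2 < σ p.1)).card

/-- The set of derangements (fixed-point-free permutations) of `Fin n`. -/
def derangeSet (n : ℕ) : Finset (Equiv.Perm (Fin n)) :=
  Finset.univ.filter (fun σ => ∀ x, σ x ≠ x)

/-- The number of derangements of `Fin n` (so `numDerange 0 = 1`). -/
def numDerange (n : ℕ) : ℕ := (derangeSet n).card

/-- The number of fixed points of a permutation of `Fin n`. -/
def fixedPointCount {n : ℕ} (σ : Equiv.Perm (Fin n)) : ℕ :=
  (Finset.univ.filter (fun x => σ x = x)).card

/-- The set of permutations of `Fin n` with exactly `k` fixed points. -/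
def permsWithFixed (n k : ℕ) : Finset (Equiv.Perm (Fin n)) :=
  Finset.univ.filter (fun σ => fixedPointCount σ = k)

/-- The number of permutations of `Fin n` with exactly `k` fixed points. -/
def numPermsWithFixed (n k : ℕ) : ℕ := (permsWithFixed n k).card

/-- The sign attached to a pair of positions: `1` if it is an inversion, `-1` otherwise. -/
def inversionSign {n : ℕ} (p : Fin n × Fin n) (σ : Equiv.Perm (Fin n)) : ℝ :=
  if σ p.2 < σ p.1 then 1 else -1

lemma abs_inversionSign {n : ℕ} (p : Fin n × Fin n) (σ : Equiv.Perm (Fin n)) :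
    |inversionSign p σ| = 1 := by
  unfold inversionSign; split_ifs <;> simp

lemma inversionSign_mul_swap {n : ℕ} {p : Fin n × Fin n} (hp : p.1 ≠ p.2)
    (σ : Equiv.Perm (Fin n)) :
    inversionSign p (σ * Equiv.swap p.1 p.2) = -inversionSign p σ := by
  have h : σ p.1 ≠ σ p.2 := fun h => hp (σ.injective h)
  unfold inversionSign
  simp only [Equiv.Perm.mul_apply, Equiv.swap_apply_left, Equiv.swap_apply_right]
  rcases lt_or_gt_of_ne h with h | h <;> simp [h, h.not_gt]

lemma inversionSign_mul_swap_of_disjoint {n : ℕ} {p q : Fin n × Fin n}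
    (h11 : p.1 ≠ q.1) (h12 : p.1 ≠ q.2) (h21 : p.2 ≠ q.1) (h22 : p.2 ≠ q.2)
    (σ : Equiv.Perm (Fin n)) :
    inversionSign q (σ * Equiv.swap p.1 p.2) = inversionSign q σ := by
  simp [inversionSign, Equiv.Perm.mul_apply,
    Equiv.swap_apply_of_ne_of_ne h11.symm h21.symm, Equiv.swap_apply_of_ne_of_ne h12.symm h22.symm]

/-- Signs of disjoint pairs of positions are uncorrelated. -/
lemma sum_inversionSign_mul_eq_zero {n : ℕ} {p q : Fin n × Fin n} (hp : p.1 ≠ p.2)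
    (h11 : p.1 ≠ q.1) (h12 : p.1 ≠ q.2) (h21 : p.2 ≠ q.1) (h22 : p.2 ≠ q.2) :
    ∑ σ : Equiv.Perm (Fin n), inversionSign p σ * inversionSign q σ = 0 := by
  have h := Equiv.sum_comp (Equiv.mulRight (Equiv.swap p.1 p.2))
    (fun σ : Equiv.Perm (Fin n) => inversionSign p σ * inversionSign q σ)
  simp only [Equiv.coe_mulRight, inversionSign_mul_swap hp,
    inversionSign_mul_swap_of_disjoint h11 h12 h21 h22, neg_mul, Finset.sum_neg_distrib] at h
  linarith

lemma sum_inversionSign_mul_le {n : ℕ} {p : Fin n × Fin n} (q : Fin n × Fin n) (hp : p.1 ≠ p.2) :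
    ∑ σ : Equiv.Perm (Fin n), inversionSign p σ * inversionSign q σ ≤
      n.factorial * ((if p.1 = q.1 then 1 else 0) + (if p.1 = q.2 then 1 else 0) +
        (if p.2 = q.1 then 1 else 0) + (if p.2 = q.2 then 1 else 0)) := by
  by_cases h : p.1 ≠ q.1 ∧ p.1 ≠ q.2 ∧ p.2 ≠ q.1 ∧ p.2 ≠ q.2
  · obtain ⟨h11, h12, h21, h22⟩ := h
    rw [sum_inversionSign_mul_eq_zero hp h11 h12 h21 h22]
    positivity
  · have h1 : ∑ σ : Equiv.Perm (Fin n), inversionSign p σ * inversionSign q σ ≤ n.factorial := by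
      calc _ ≤ ∑ _σ : Equiv.Perm (Fin n), (1 : ℝ) := Finset.sum_le_sum fun σ _ => by
            refine (le_abs_self _).trans ?_
            rw [abs_mul, abs_inversionSign, abs_inversionSign, one_mul]
        _ = n.factorial := by simp [Fintype.card_perm]
    refine h1.trans (le_mul_of_one_le_right (by positivity) ?_)
    split_ifs <;> first | (exfalso; tauto) | norm_num

/-- The pairs of positions `a < b`. -/
def orderedPairs (n : ℕ) : Finset (Fin n × Fin n) :=
  Finset.univ.filter (fun p => p.1 < p.2)

lemma two_mul_card_orderedPairs_add (n : ℕ) : 2 * (orderedPairs n).card + n = n ^ 2 := by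
  have h1 : (orderedPairs n).card = ∑ i ∈ Finset.range n, i := by
    rw [orderedPairs, Finset.card_filter, Fintype.sum_prod_type_right,
      ← Fin.sum_univ_eq_sum_range (fun i => i)]
    refine Finset.sum_congr rfl fun b _ => ?_
    rw [← Finset.card_filter]
    rw [Finset.filter_gt_eq_Iio, Fin.card_Iio]
  rw [h1, mul_comm, Finset.sum_range_id_mul_two]
  cases n <;> simp; ring

lemma sum_inversionSign_eq {n : ℕ} (σ : Equiv.Perm (Fin n)) :
    ∑ p ∈ orderedPairs n, inversionSign p σ = 2 * inversions σ - (orderedPairs n).card := by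
  have h : (inversions σ : ℝ) = ∑ p ∈ orderedPairs n, if σ p.2 < σ p.1 then 1 else 0 := by
    rw [inversions, ← Finset.filter_filter, Finset.card_filter]
    simp [orderedPairs]
  rw [h, Finset.mul_sum, Finset.card_eq_sum_ones, Nat.cast_sum, ← Finset.sum_sub_distrib]
  refine Finset.sum_congr rfl fun p _ => ?_
  unfold inversionSign; split_ifs <;> norm_num

lemma sum_sq_sum_inversionSign_le (n : ℕ) :
    ∑ σ : Equiv.Perm (Fin n), (∑ p ∈ orderedPairs n, inversionSign p σ) ^ 2 ≤
      n.factorial * (4 * (n : ℝ) ^ 3) := by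
  calc ∑ σ : Equiv.Perm (Fin n), (∑ p ∈ orderedPairs n, inversionSign p σ) ^ 2
      = ∑ p ∈ orderedPairs n, ∑ q ∈ orderedPairs n,
          ∑ σ : Equiv.Perm (Fin n), inversionSign p σ * inversionSign q σ := by
        simp_rw [sq, Finset.sum_mul_sum]
        rw [Finset.sum_comm]
        exact Finset.sum_congr rfl fun p _ => Finset.sum_comm
    _ ≤ ∑ p ∈ orderedPairs n, ∑ q ∈ orderedPairs n,
          (n.factorial * ((if p.1 = q.1 then 1 else 0) + (if p.1 = q.2 then 1 else 0) +
            (if p.2 = q.1 then 1 else 0) + (if p.2 = q.2 then 1 else 0)) : ℝ) := by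
        refine Finset.sum_le_sum fun p hp => Finset.sum_le_sum fun q _ => ?_
        exact sum_inversionSign_mul_le q (Finset.mem_filter.1 hp).2.ne
    _ ≤ ∑ p : Fin n × Fin n, ∑ q : Fin n × Fin n,
          (n.factorial * ((if p.1 = q.1 then 1 else 0) + (if p.1 = q.2 then 1 else 0) +
            (if p.2 = q.1 then 1 else 0) + (if p.2 = q.2 then 1 else 0)) : ℝ) := by
        refine (Finset.sum_le_sum fun p _ => Finset.sum_le_sum_of_subset_of_nonneg
          (Finset.subset_univ _) fun _ _ _ => by positivity).trans ?_
        exact Finset.sum_le_sum_of_subset_of_nonneg (Finset.subset_univ _)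
          fun _ _ _ => Finset.sum_nonneg fun _ _ => by positivity
    _ = n.factorial * (4 * (n : ℝ) ^ 3) := by
        simp_rw [← Finset.mul_sum, Fintype.sum_prod_type, Finset.sum_add_distrib]
        have hc : ∀ x : Fin n, ∑ y : Fin n, ∑ _z : Fin n, (if x = y then (1 : ℝ) else 0) = n := by
          intro x
          rw [Finset.sum_comm]
          simp
        simp only [hc]
        simp
        left
        ring

open scoped Classical in
/-- Chebyshev's bound for the number of permutations with atypically many or few inversions. -/
lemma card_inversions_atypical_le {n : ℕ} {ε : ℝ} (hε : 0 < ε) (hn : 2 ≤ ε * n) :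
    ((Finset.univ.filter fun σ : Equiv.Perm (Fin n) =>
      ¬ ((1 - ε) * (n : ℝ) ^ 2 / 4 ≤ (inversions σ : ℝ) ∧
        (inversions σ : ℝ) ≤ (1 + ε) * (n : ℝ) ^ 2 / 4)).card : ℝ) ≤
      n.factorial * (64 / (ε ^ 2 * n)) := by
  have hn0 : (0 : ℝ) < n := by
    by_contra h
    nlinarith
  set B := Finset.univ.filter fun σ : Equiv.Perm (Fin n) =>
      ¬ ((1 - ε) * (n : ℝ) ^ 2 / 4 ≤ (inversions σ : ℝ) ∧
        (inversions σ : ℝ) ≤ (1 + ε) * (n : ℝ) ^ 2 / 4) with hB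
  have hP : 2 * ((orderedPairs n).card : ℝ) + n = n ^ 2 := by
    exact_mod_cast two_mul_card_orderedPairs_add n
  have hgap : 2 * (n : ℝ) ≤ ε * n ^ 2 := by nlinarith
  have hlow : ∀ σ ∈ B, (ε * n ^ 2 / 4) ^ 2 ≤ (∑ p ∈ orderedPairs n, inversionSign p σ) ^ 2 := by
    intro σ hσ
    rw [hB, Finset.mem_filter, not_and_or, not_le, not_le] at hσ
    rw [sum_inversionSign_eq, sq_le_sq, abs_of_nonneg (by positivity : 0 ≤ ε * (n : ℝ) ^ 2 / 4),
      le_abs]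
    rcases hσ.2 with h | h
    · right; linarith
    · left; linarith
  have h := calc (B.card : ℝ) * (ε * n ^ 2 / 4) ^ 2
      = ∑ _σ ∈ B, (ε * (n : ℝ) ^ 2 / 4) ^ 2 := by simp
    _ ≤ ∑ σ ∈ B, (∑ p ∈ orderedPairs n, inversionSign p σ) ^ 2 := Finset.sum_le_sum hlow
    _ ≤ ∑ σ : Equiv.Perm (Fin n), (∑ p ∈ orderedPairs n, inversionSign p σ) ^ 2 :=
        Finset.sum_le_sum_of_subset_of_nonneg (Finset.subset_univ _) fun _ _ _ => sq_nonneg _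
    _ ≤ n.factorial * (4 * (n : ℝ) ^ 3) := sum_sq_sum_inversionSign_le n
  rw [← mul_le_mul_iff_left₀ (by positivity : 0 < (ε * (n : ℝ) ^ 2 / 4) ^ 2)]
  refine h.trans_eq ?_
  field_simp
  norm_num

lemma card_filter_fixed_eq {n : ℕ} (s : Finset (Fin n)) :
    (Finset.univ.filter fun σ : Equiv.Perm (Fin n) =>
      Finset.univ.filter (fun x => σ x = x) = s).card = numDerangements (n - s.card) := by
  have h := Fintype.card_congr (derangements.subtypeEquiv (fun x : Fin n => x ∉ s))
  rw [card_derangements_eq_numDerangements, Fintype.card_subtype_compl] at h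
  simp only [Fintype.card_fin, Fintype.card_coe] at h
  rw [h, Fintype.card_subtype]
  congr 1
  ext σ
  simp only [Finset.mem_filter, Finset.mem_univ, true_and, Finset.ext_iff, not_not,
    Function.mem_fixedPoints, Function.IsFixedPt]
  exact forall_congr' fun _ => Iff.comm

lemma numPermsWithFixed_eq (n k : ℕ) :
    numPermsWithFixed n k = n.choose k * numDerangements (n - k) := by
  rw [numPermsWithFixed, Finset.card_eq_sum_card_fiberwise
    (f := fun σ : Equiv.Perm (Fin n) => Finset.univ.filter fun x => σ x = x)
    (t := Finset.univ.powersetCard k)]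
  · rw [Finset.sum_congr rfl (g := fun _ => numDerangements (n - k))]
    · simp
    · intro s hs
      rw [Finset.mem_powersetCard] at hs
      rw [← hs.2, ← card_filter_fixed_eq s, permsWithFixed, Finset.filter_filter]
      congr 1
      ext σ
      simp only [Finset.mem_filter, Finset.mem_univ, true_and, and_iff_right_iff_imp]
      rintro rfl
      rfl
  · intro σ hσ
    rw [Finset.mem_coe, permsWithFixed, Finset.mem_filter] at hσ
    simpa [fixedPointCount] using hσ.2

open Filter Topology in
lemma tendsto_numPermsWithFixed_div_factorial (k : ℕ) :
    Tendsto (fun n => (numPermsWithFixed n k : ℝ) / n.factorial) atTop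
      (𝓝 (Real.exp (-1) / k.factorial)) := by
  refine ((numDerangements_tendsto_inv_e.comp (tendsto_sub_atTop_nat k)).div_const
    (k.factorial : ℝ)).congr' ?_
  filter_upwards [eventually_ge_atTop k] with n hn
  rw [numPermsWithFixed_eq, ← Nat.choose_mul_factorial_mul_factorial hn]
  have := Nat.choose_pos hn
  simp only [Function.comp_apply]
  push_cast
  field_simp

open scoped Classical in
/-- Weak law of large numbers for the inversion statistic on random permutations with
exactly `k` fixed points. -/
theorem stmt7 (k : ℕ) (ε : ℝ) (hε : 0 < ε) :
    Filter.Tendsto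
      (fun n => (((permsWithFixed n k).filter
            (fun σ => (1 - ε) * (n : ℝ) ^ 2 / 4 ≤ (inversions σ : ℝ) ∧
              (inversions σ : ℝ) ≤ (1 + ε) * (n : ℝ) ^ 2 / 4)).card : ℝ) /
        (numPermsWithFixed n k : ℝ))
      Filter.atTop (nhds 1) := by
  have hd := tendsto_numPermsWithFixed_div_factorial k
  have hL : 0 < Real.exp (-1) / k.factorial := by positivity
  have hnum : Filter.Tendsto (fun n : ℕ => 64 / (ε ^ 2 * n)) Filter.atTop (nhds 0) :=
    (tendsto_natCast_atTop_atTop.const_mul_atTop (by positivity)).const_div_atTop 64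
  have hlim := (hnum.div hd hL.ne').const_sub 1
  rw [zero_div, sub_zero] at hlim
  refine tendsto_of_tendsto_of_tendsto_of_le_of_le' hlim tendsto_const_nhds ?_ ?_
  · filter_upwards [hd.eventually (lt_mem_nhds hL),
      (tendsto_natCast_atTop_atTop.const_mul_atTop hε).eventually_ge_atTop 2] with n hpos hn
    have hfac : (0 : ℝ) < n.factorial := by positivity
    have hD : (0 : ℝ) < numPermsWithFixed n k := (div_pos_iff_of_pos_right hfac).1 hpos
    have hsplit := Finset.card_filter_add_card_filter_not (s := permsWithFixed n k)
      (fun σ => (1 - ε) * (n : ℝ) ^ 2 / 4 ≤ (inversions σ : ℝ) ∧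
        (inversions σ : ℝ) ≤ (1 + ε) * (n : ℝ) ^ 2 / 4)
    have hbad := (Nat.cast_le (α := ℝ).2 (Finset.card_le_card (Finset.filter_subset_filter
      (fun σ => ¬ ((1 - ε) * (n : ℝ) ^ 2 / 4 ≤ (inversions σ : ℝ) ∧
        (inversions σ : ℝ) ≤ (1 + ε) * (n : ℝ) ^ 2 / 4))
      (Finset.subset_univ (permsWithFixed n k))))).trans (card_inversions_atypical_le hε hn)
    rw [← Nat.cast_inj (R := ℝ), Nat.cast_add] at hsplit
    change _ = (numPermsWithFixed n k : ℝ) at hsplit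
    rw [le_div_iff₀ hD, sub_mul, one_mul]
    have : 64 / (ε ^ 2 * (n : ℝ)) / ((numPermsWithFixed n k : ℝ) / n.factorial) *
        numPermsWithFixed n k = n.factorial * (64 / (ε ^ 2 * n)) := by
      field_simp
    simp only [Pi.div_apply]
    linarith
  · refine Filter.Eventually.of_forall fun n => ?_
    exact div_le_one_of_le₀ (Nat.cast_le.2 (Finset.card_filter_le _ _)) (Nat.cast_nonneg _)
end

section
/- For every integer n ≥ 2 and every j ∈ {1,…,n}, the number of derangements of {1,…,n} in which j lies in a cycle of length at least 3 satisfies #{σ ∈ D_n : σ(σ(j)) ≠ j} = (n−1)·d_{n−1}. -/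
/-- Permutations whose only fixed point is `j` are counted by derangements of the complement. -/
theorem card_perm_fixing_only {α : Type*} [Fintype α] [DecidableEq α] (j : α) :
    (Finset.univ.filter fun τ : Equiv.Perm α => ∀ x, τ x = x ↔ x = j).card =
      numDerangements (Fintype.card α - 1) := by
  have h := card_derangements_eq_numDerangements {x : α // x ≠ j}
  rw [Fintype.card_subtype_compl, Fintype.card_subtype_eq] at h
  rw [← h, ← Fintype.card_subtype]
  refine Fintype.card_congr ((derangements.subtypeEquiv fun x => x ≠ j).trans
    (Equiv.subtypeEquivRight fun f => forall_congr' fun x => ?_)).symm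
  rw [not_not, Function.mem_fixedPoints_iff]
  exact iff_comm

/-- Composing with the transposition of `j` and `σ j` splits off `j` from its cycle. -/
theorem card_derangements_long_cycle {α : Type*} [Fintype α] [DecidableEq α] (j : α) :
    (Finset.univ.filter fun σ : Equiv.Perm α => (∀ x, σ x ≠ x) ∧ σ (σ j) ≠ j).card =
      (Fintype.card α - 1) * numDerangements (Fintype.card α - 1) := by
  rw [← card_perm_fixing_only j, ← Finset.card_univ, ← Finset.card_erase_of_mem
    (Finset.mem_univ j), ← Finset.card_product]
  refine Finset.card_bij' (fun σ _ => (σ j, Equiv.swap j (σ j) * σ))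
    (fun p _ => Equiv.swap j p.1 * p.2) ?_ ?_ ?_ ?_
  · intro σ hσ
    simp only [Finset.mem_filter, Finset.mem_univ, true_and] at hσ
    simp only [Finset.mem_product, Finset.mem_erase, Finset.mem_filter, Finset.mem_univ,
      true_and, and_true, Equiv.Perm.mul_apply]
    refine ⟨hσ.1 j, fun x => ⟨fun hx => ?_, ?_⟩⟩
    · by_contra hxj
      have hne : σ x ≠ σ j := σ.injective.ne hxj
      rw [Equiv.swap_apply_def] at hx
      split_ifs at hx with h
      · exact hσ.2 (hx ▸ h)
      · exact hσ.1 x hx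
    · rintro rfl
      exact Equiv.swap_apply_right _ _
  · rintro ⟨k, τ⟩ hp
    simp only [Finset.mem_product, Finset.mem_erase, Finset.mem_filter, Finset.mem_univ,
      true_and, and_true] at hp
    obtain ⟨hk, hτ⟩ := hp
    have hj : τ j = j := (hτ j).2 rfl
    simp only [Finset.mem_filter, Finset.mem_univ, true_and, Equiv.Perm.mul_apply, hj,
      Equiv.swap_apply_left]
    constructor
    · intro x
      rw [Equiv.swap_apply_def]
      have hinj : τ x = j → x = j := fun h => τ.injective (h.trans hj.symm)
      grind
    · rw [ne_eq, Equiv.swap_apply_eq_iff, Equiv.swap_apply_left, hτ]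
      exact hk
  · intro σ _
    simp
  · rintro ⟨k, τ⟩ hp
    simp only [Finset.mem_product, Finset.mem_filter] at hp
    have hj : τ j = j := (hp.2.2 j).2 rfl
    simp [hj]

theorem numDerange_eq_numDerangements (n : ℕ) : numDerange n = numDerangements n := by
  rw [← card_derangements_fin_eq_numDerangements, numDerange, derangeSet,
    ← Fintype.card_subtype]
  exact Fintype.card_congr (Equiv.refl _)

/-- The number of derangements of `{1,…,n}` in which `j` lies in a cycle of length at
least 3 is `(n-1) · d_{n-1}`. -/
theorem stmt12 (n j : ℕ) (hn : 2 ≤ n) (hj1 : 1 ≤ j) (hj2 : j ≤ n) :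
    ((derangeSet n).filter
        (fun σ => σ (σ (⟨j - 1, by omega⟩ : Fin n)) ≠ (⟨j - 1, by omega⟩ : Fin n))).card =
      (n - 1) * numDerange (n - 1) := by
  have h := card_derangements_long_cycle (⟨j - 1, by omega⟩ : Fin n)
  rw [Fintype.card_fin] at h
  rw [derangeSet, Finset.filter_filter, numDerange_eq_numDerangements, ← h]
  congr!
end
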